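/- Let d ≥ 1 be an integer, β ∈ (0, min(d,2)), T > 0, let σ, b : ℝ → ℝ be Lipschitz continuous, let w : [0,T]×ℝ^d → ℝ be bounded and continuous, and let h : [0,T]×ℝ^d → ℝ be admissible. Then there exists exactly one bounded measurable function Φ : [0,T]×ℝ^d → ℝ such that for every (t,x) ∈ [0,T]×ℝ^d, Φ(t,x) = w(t,x) + ∫₀ᵗ ∫_{ℝ^d} ∫_{ℝ^d} Λ(t−s, x−y) σ(Φ(s,y)) |y−y′|^{−β} h(s,y′) dy′ dy ds + ∫₀ᵗ ∫_{ℝ^d} Λ(t−s, x−y) b(Φ(s,y)) dy ds, all integrals being absolutely convergent. -/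

import Mathlib

open MeasureTheory Real Set

noncomputable section

/-- Euclidean space `ℝ^d`. -/
abbrev Ed (d : ℕ) := EuclideanSpace ℝ (Fin d)

/-- The heat kernel `Λ(t,x) = (4πt)^{−d/2} exp(−|x|²/(4t))` on `ℝ^d`. -/
def heatKernel (d : ℕ) (t : ℝ) (x : Ed d) : ℝ :=
  (4 * π * t) ^ (-(d : ℝ) / 2) * Real.exp (-‖x‖ ^ 2 / (4 * t))

/-- A measurable function `g : [0,T]×ℝ^d → ℝ` is admissible if
`∫₀ᵀ ∫∫ |g(s,y)| |g(s,y′)| |y−y′|^{−β} dy dy′ ds < ∞`. -/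
def Admissible (d : ℕ) (β T : ℝ) (g : ℝ → Ed d → ℝ) : Prop :=
  Measurable (fun p : ℝ × Ed d => g p.1 p.2) ∧
  (∫⁻ s in Ioc (0 : ℝ) T, ∫⁻ y : Ed d, ∫⁻ y' : Ed d,
    ENNReal.ofReal (|g s y| * |g s y'| * ‖y - y'‖ ^ (-β))) < ⊤

/-- `Φ` is a bounded measurable solution on `[0,T]×ℝ^d` of the skeleton equation
`Φ(t,x) = w(t,x) + ∫₀ᵗ ∫∫ Λ(t−s,x−y) σ(Φ(s,y)) |y−y′|^{−β} h(s,y′) dy′ dy ds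
          + ∫₀ᵗ ∫ Λ(t−s,x−y) b(Φ(s,y)) dy ds`,
all integrals being absolutely convergent. -/
structure IsSkeletonSolution (d : ℕ) (β T : ℝ) (σ b : ℝ → ℝ)
    (w : ℝ → Ed d → ℝ) (h : ℝ → Ed d → ℝ) (Φ : ℝ → Ed d → ℝ) : Prop where
  measurable : Measurable (fun p : ℝ × Ed d => Φ p.1 p.2)
  bounded : ∃ M : ℝ, ∀ t ∈ Icc (0 : ℝ) T, ∀ x : Ed d, |Φ t x| ≤ M
  abs_conv_noise : ∀ t ∈ Icc (0 : ℝ) T, ∀ x : Ed d,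
    (∫⁻ s in Ioc (0 : ℝ) t, ∫⁻ y : Ed d, ∫⁻ y' : Ed d,
      ENNReal.ofReal
        (|heatKernel d (t - s) (x - y) * σ (Φ s y) * ‖y - y'‖ ^ (-β) * h s y'|)) < ⊤
  abs_conv_drift : ∀ t ∈ Icc (0 : ℝ) T, ∀ x : Ed d,
    (∫⁻ s in Ioc (0 : ℝ) t, ∫⁻ y : Ed d,
      ENNReal.ofReal (|heatKernel d (t - s) (x - y) * b (Φ s y)|)) < ⊤
  eqn : ∀ t ∈ Icc (0 : ℝ) T, ∀ x : Ed d,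
    Φ t x = w t x
      + (∫ s in Ioc (0 : ℝ) t, ∫ y : Ed d, ∫ y' : Ed d,
          heatKernel d (t - s) (x - y) * σ (Φ s y) * ‖y - y'‖ ^ (-β) * h s y')
      + ∫ s in Ioc (0 : ℝ) t, ∫ y : Ed d, heatKernel d (t - s) (x - y) * b (Φ s y)

section SkProof
open Filter Topology
open scoped ENNReal

lemma sk_lintegral_gauss (d : ℕ) {b : ℝ} (hb : 0 < b) (m : Ed d) :
    ∫⁻ z : Ed d, ENNReal.ofReal (rexp (-b * ‖z - m‖ ^ 2)) =
      ENNReal.ofReal ((π / b) ^ ((d : ℝ) / 2)) := by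
  have h1 := GaussianFourier.integral_rexp_neg_mul_sq_norm (V := Ed d) hb
  rw [finrank_euclideanSpace_fin] at h1
  have hpos : 0 < (π / b) ^ ((d : ℝ) / 2) := by positivity
  have hint : Integrable (fun v : Ed d => rexp (-b * ‖v‖ ^ 2)) :=
    .of_integral_ne_zero (by rw [h1]; exact hpos.ne')
  rw [lintegral_sub_right_eq_self (fun z : Ed d => ENNReal.ofReal (rexp (-b * ‖z‖ ^ 2))) m,
    ← h1, ofReal_integral_eq_lintegral_ofReal hint (ae_of_all _ fun _ => (exp_pos _).le)]

lemma sk_lintegral_gamma {a r : ℝ} (ha : 0 < a) (hr : 0 < r) :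
    ∫⁻ t in Ioi (0 : ℝ), ENNReal.ofReal (t ^ (a - 1) * rexp (-(r * t))) =
      ENNReal.ofReal ((1 / r) ^ a * Gamma a) := by
  have h1 := integral_rpow_mul_exp_neg_mul_Ioi ha hr
  have hpos : 0 < (1 / r) ^ a * Gamma a := mul_pos (by positivity) (Gamma_pos_of_pos ha)
  have hint : IntegrableOn (fun x : ℝ ↦ x ^ (a - 1) * rexp (-(r * x))) (Ioi 0) :=
    .of_integral_ne_zero (by rw [h1]; exact hpos.ne')
  rw [← h1, ofReal_integral_eq_lintegral_ofReal hint]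
  filter_upwards [ae_restrict_mem measurableSet_Ioi] with t ht
  have : (0 : ℝ) < t := ht
  positivity

lemma sk_heat_meas (d : ℕ) : Measurable (fun p : ℝ × Ed d => heatKernel d p.1 p.2) := by
  unfold heatKernel
  fun_prop

lemma sk_heat_nonneg (d : ℕ) {t : ℝ} (ht : 0 ≤ t) (x : Ed d) : 0 ≤ heatKernel d t x := by
  unfold heatKernel
  positivity

lemma sk_heat_le (d : ℕ) {t : ℝ} (ht : 0 < t) (x : Ed d) :
    heatKernel d t x ≤ t ^ (-(d : ℝ) / 2) := by
  unfold heatKernel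
  have h1 : rexp (-‖x‖ ^ 2 / (4 * t)) ≤ 1 := by
    rw [Real.exp_le_one_iff]
    apply div_nonpos_of_nonpos_of_nonneg <;> [nlinarith [sq_nonneg ‖x‖]; positivity]
  have h2 : (4 * π * t) ^ (-(d : ℝ) / 2) ≤ t ^ (-(d : ℝ) / 2) := by
    apply rpow_le_rpow_of_nonpos ht
    · nlinarith [pi_gt_three]
    · have : (0 : ℝ) ≤ d := by positivity
      linarith
  calc _ ≤ (4 * π * t) ^ (-(d : ℝ) / 2) * 1 := by gcongr
    _ ≤ _ := by rw [mul_one]; exact h2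

lemma sk_heat_lintegral (d : ℕ) {t : ℝ} (ht : 0 < t) (x : Ed d) :
    ∫⁻ y : Ed d, ENNReal.ofReal (heatKernel d t (x - y)) = 1 := by
  unfold heatKernel
  have h0 : 0 ≤ (4 * π * t) ^ (-(d : ℝ) / 2) := by positivity
  simp_rw [ENNReal.ofReal_mul h0]
  rw [lintegral_const_mul _ (by fun_prop)]
  have : ∀ y : Ed d, rexp (-‖x - y‖ ^ 2 / (4 * t)) = rexp (-(1 / (4 * t)) * ‖y - x‖ ^ 2) := by
    intro y
    rw [norm_sub_rev]; congr 1; ring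
  simp_rw [this]
  rw [sk_lintegral_gauss d (by positivity), ← ENNReal.ofReal_mul h0]
  have h3 : π / (1 / (4 * t)) = 4 * π * t := by field_simp
  rw [h3, ← rpow_add (by positivity)]
  simp [neg_div]

/-- Riesz kernel -/
def skK (d : ℕ) (β : ℝ) (y y' : Ed d) : ℝ≥0∞ := ENNReal.ofReal (‖y - y'‖ ^ (-β))

lemma skK_meas (d : ℕ) (β : ℝ) : Measurable (fun p : Ed d × Ed d => skK d β p.1 p.2) := by
  unfold skK
  fun_prop

def skPsi (d : ℕ) (β : ℝ) (p : ℝ × Ed d) (y : Ed d) : ℝ≥0∞ :=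
  ENNReal.ofReal (p.1 ^ ((β / 2 - 1 + (d : ℝ) / 2) / 2) * rexp (-2 * p.1 * ‖y - p.2‖ ^ 2))

lemma skPsi_meas (d : ℕ) (β : ℝ) :
    Measurable (fun p : (ℝ × Ed d) × Ed d => skPsi d β p.1 p.2) := by
  unfold skPsi
  fun_prop

lemma sk_par (d : ℕ) (y y' z : Ed d) :
    ‖y - z‖ ^ 2 + ‖y' - z‖ ^ 2 = 2 * ‖z - (1 / 2 : ℝ) • (y + y')‖ ^ 2 + (1 / 2) * ‖y - y'‖ ^ 2 := by
  have h := parallelogram_law_with_norm ℝ (y - z) (y' - z)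
  have e1 : y - z + (y' - z) = (-2 : ℝ) • (z - (1 / 2 : ℝ) • (y + y')) := by
    module
  have e2 : y - z - (y' - z) = y - y' := by abel
  rw [e1, e2, norm_smul, show ‖(-2 : ℝ)‖ = 2 by norm_num] at h
  nlinarith

def skMu (d : ℕ) : Measure (ℝ × Ed d) := (volume.restrict (Ioi (0 : ℝ))).prod volume

instance (d : ℕ) : SFinite (skMu d) := by unfold skMu; infer_instance

def skC (d : ℕ) (β : ℝ) : ℝ := (π / 4) ^ ((d : ℝ) / 2) * Gamma (β / 2)

lemma skPsi_repr (d : ℕ) {β : ℝ} (hβ : 0 < β) {y y' : Ed d} (hy : y ≠ y') :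
    ∫⁻ p, skPsi d β p y * skPsi d β p y' ∂(skMu d) =
      ENNReal.ofReal (skC d β) * skK d β y y' := by
  have hr : 0 < ‖y - y'‖ := norm_pos_iff.2 (sub_ne_zero.2 hy)
  have hm : Measurable (fun p => skPsi d β p y * skPsi d β p y') := by
    unfold skPsi; fun_prop
  unfold skMu
  rw [lintegral_prod _ hm.aemeasurable]
  have hin : ∀ a ∈ Ioi (0 : ℝ), ∫⁻ z : Ed d, skPsi d β (a, z) y * skPsi d β (a, z) y' =
      ENNReal.ofReal ((π / 4) ^ ((d : ℝ) / 2)) *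
        ENNReal.ofReal (a ^ (β / 2 - 1) * rexp (-(‖y - y'‖ ^ 2 * a))) := by
    intro a ha
    have ha : 0 < a := ha
    have : ∀ z : Ed d, skPsi d β (a, z) y * skPsi d β (a, z) y' =
        ENNReal.ofReal (a ^ (β / 2 - 1 + (d : ℝ) / 2) * rexp (-(‖y - y'‖ ^ 2 * a))) *
        ENNReal.ofReal (rexp (-(4 * a) * ‖z - (1 / 2 : ℝ) • (y + y')‖ ^ 2)) := by
      intro z
      unfold skPsi
      rw [← ENNReal.ofReal_mul (by positivity), ← ENNReal.ofReal_mul (by positivity)]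
      congr 1
      have e1 : a ^ (β / 2 - 1 + (d : ℝ) / 2) = a ^ ((β / 2 - 1 + (d : ℝ) / 2) / 2) *
          a ^ ((β / 2 - 1 + (d : ℝ) / 2) / 2) := by
        rw [← rpow_add ha]; congr 1; ring
      have e2 : rexp (-2 * a * ‖y - z‖ ^ 2) * rexp (-2 * a * ‖y' - z‖ ^ 2) =
          rexp (-(‖y - y'‖ ^ 2 * a)) *
            rexp (-(4 * a) * ‖z - (1 / 2 : ℝ) • (y + y')‖ ^ 2) := by
        rw [← Real.exp_add, ← Real.exp_add]
        congr 1
        have := sk_par d y y' z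
        linear_combination (-2 * a) * this
      simp only
      rw [e1]
      linear_combination (a ^ ((β / 2 - 1 + (d : ℝ) / 2) / 2) *
          a ^ ((β / 2 - 1 + (d : ℝ) / 2) / 2)) * e2
    simp_rw [this]
    rw [lintegral_const_mul _ (by fun_prop), sk_lintegral_gauss d (by positivity),
      ← ENNReal.ofReal_mul (by positivity), ← ENNReal.ofReal_mul (by positivity)]
    congr 1
    rw [rpow_add ha, show π / (4 * a) = (π / 4) / a by field_simp,
      div_rpow (by positivity) ha.le]
    have : a ^ ((d : ℝ) / 2) ≠ 0 := by positivity
    field_simp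
  rw [setLIntegral_congr_fun measurableSet_Ioi hin, lintegral_const_mul _ (by fun_prop),
    sk_lintegral_gamma (by positivity) (by positivity)]
  unfold skC skK
  rw [← ENNReal.ofReal_mul (by positivity), ← ENNReal.ofReal_mul]
  · congr 1
    have : (1 / ‖y - y'‖ ^ 2) ^ (β / 2) = ‖y - y'‖ ^ (-β) := by
      rw [one_div, ← rpow_natCast, ← rpow_neg hr.le, ← rpow_mul hr.le]
      congr 1; push_cast; ring
    rw [this]; ring
  · exact mul_nonneg (by positivity) (Gamma_pos_of_pos (by positivity)).le

lemma skC_pos (d : ℕ) {β : ℝ} (hβ : 0 < β) : 0 < skC d β :=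
  mul_pos (by positivity) (Gamma_pos_of_pos (by positivity))

/-- energy form -/
def skD (d : ℕ) (β : ℝ) (f g : Ed d → ℝ≥0∞) : ℝ≥0∞ :=
  ∫⁻ y, ∫⁻ y', f y * g y' * skK d β y y'

lemma sk_gen {P E : Type*} [MeasurableSpace P] [MeasurableSpace E] (μ : Measure P) [SFinite μ]
    (ν : Measure E) [SFinite ν] {ψ : P → E → ℝ≥0∞}
    (hP : Measurable (fun p : P × E => ψ p.1 p.2)) {f g : E → ℝ≥0∞}
    (hf : Measurable f) (hg : Measurable g) :
    ∫⁻ p, (∫⁻ y, f y * ψ p y ∂ν) * (∫⁻ y, g y * ψ p y ∂ν) ∂μ =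
      ∫⁻ y, ∫⁻ y', f y * g y' * ∫⁻ p, ψ p y * ψ p y' ∂μ ∂ν ∂ν := by
  have hPy : ∀ p, Measurable (fun y => ψ p y) := fun p =>
    hP.comp (measurable_const.prodMk measurable_id)
  have hPp : ∀ y, Measurable (fun p => ψ p y) := fun y =>
    hP.comp (measurable_id.prodMk measurable_const)
  have h1 : ∀ p, (∫⁻ y, f y * ψ p y ∂ν) * (∫⁻ y, g y * ψ p y ∂ν) =
      ∫⁻ y, ∫⁻ y', (f y * ψ p y) * (g y' * ψ p y') ∂ν ∂ν := by
    intro p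
    rw [← lintegral_mul_const _ (by fun_prop)]
    refine lintegral_congr fun y => ?_
    rw [lintegral_const_mul _ (by fun_prop)]
  rw [lintegral_congr h1, lintegral_lintegral_swap]
  swap
  · apply Measurable.aemeasurable
    apply Measurable.lintegral_prod_right'
      (f := fun q : (P × E) × E =>
        f q.1.2 * ψ q.1.1 q.1.2 * (g q.2 * ψ q.1.1 q.2))
    have a2 : Measurable fun q : (P × E) × E => ψ q.1.1 q.2 :=
      hP.comp ((measurable_fst.comp measurable_fst).prodMk measurable_snd)
    exact ((hf.comp (measurable_snd.comp measurable_fst)).mul (hP.comp measurable_fst)).mul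
      ((hg.comp measurable_snd).mul a2)
  refine lintegral_congr fun y => ?_
  rw [lintegral_lintegral_swap]
  swap
  · apply Measurable.aemeasurable
    exact (((hPp y).comp measurable_fst).const_mul (f y)).mul ((hg.comp measurable_snd).mul hP)
  refine lintegral_congr fun y' => ?_
  rw [← lintegral_const_mul _ (by fun_prop)]
  refine lintegral_congr fun p => ?_
  ring

lemma skD_repr (d : ℕ) (hd : 1 ≤ d) {β : ℝ} (hβ : 0 < β) {f g : Ed d → ℝ≥0∞}
    (hf : Measurable f) (hg : Measurable g) :
    ENNReal.ofReal (skC d β) * skD d β f g =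
      ∫⁻ p, (∫⁻ y, f y * skPsi d β p y) * (∫⁻ y, g y * skPsi d β p y) ∂(skMu d) := by
  have : NeZero d := ⟨by omega⟩
  rw [sk_gen (skMu d) volume (skPsi_meas d β) hf hg]
  unfold skD
  rw [← lintegral_const_mul' _ _ ENNReal.ofReal_ne_top]
  refine lintegral_congr fun y => ?_
  rw [← lintegral_const_mul' _ _ ENNReal.ofReal_ne_top]
  refine lintegral_congr_ae ?_
  have hne : ∀ᵐ y' : Ed d, y' ≠ y := by
    rw [ae_iff]; simp
  filter_upwards [hne] with y' hy'
  rw [skPsi_repr d hβ hy'.symm]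
  ring

lemma sk_cs {α : Type*} [MeasurableSpace α] (μ : Measure α) {f g : α → ℝ≥0∞}
    (hf : Measurable f) (hg : Measurable g) :
    ∫⁻ a, f a * g a ∂μ ≤ (∫⁻ a, f a * f a ∂μ) ^ (1 / 2 : ℝ) * (∫⁻ a, g a * g a ∂μ) ^ (1 / 2 : ℝ) := by
  have h := ENNReal.lintegral_mul_le_Lp_mul_Lq μ Real.HolderConjugate.two_two
    hf.aemeasurable hg.aemeasurable
  simpa [← pow_two] using h

lemma skD_cs (d : ℕ) (hd : 1 ≤ d) {β : ℝ} (hβ : 0 < β) {f g : Ed d → ℝ≥0∞}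
    (hf : Measurable f) (hg : Measurable g) :
    skD d β f g ≤ (skD d β f f) ^ (1 / 2 : ℝ) * (skD d β g g) ^ (1 / 2 : ℝ) := by
  have hC0 : ENNReal.ofReal (skC d β) ≠ 0 := by
    simpa using skC_pos d hβ
  have hCt : ENNReal.ofReal (skC d β) ≠ ⊤ := ENNReal.ofReal_ne_top
  have hP := skPsi_meas d β
  have hm : ∀ f : Ed d → ℝ≥0∞, Measurable f → Measurable fun p => ∫⁻ y, f y * skPsi d β p y := by
    intro f hf
    apply Measurable.lintegral_prod_right'
      (f := fun q : (ℝ × Ed d) × Ed d => f q.2 * skPsi d β q.1 q.2)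
    exact (hf.comp measurable_snd).mul hP
  have h := sk_cs (skMu d) (hm f hf) (hm g hg)
  rw [← skD_repr d hd hβ hf hg, ← skD_repr d hd hβ hf hf, ← skD_repr d hd hβ hg hg,
    ENNReal.mul_rpow_of_nonneg _ _ (by norm_num), ENNReal.mul_rpow_of_nonneg _ _ (by norm_num),
    mul_mul_mul_comm, ← ENNReal.rpow_add _ _ hC0 hCt] at h
  norm_num at h
  rw [ENNReal.mul_le_mul_iff_right hC0 hCt] at h
  simpa using h

lemma sk_ball (d : ℕ) (hd : 1 ≤ d) {β : ℝ} (hβd : β < d) :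
    ∃ C : ℝ, 0 ≤ C ∧ ∀ R : ℝ, 0 < R →
      ∫⁻ z : Ed d, ENNReal.ofReal ((Iio R).indicator (fun r : ℝ => r ^ (-β)) ‖z‖) ≤
        ENNReal.ofReal (C * R ^ ((d : ℝ) - β)) := by
  have : NeZero d := ⟨by omega⟩
  have : Nontrivial (Ed d) := inferInstance
  set V := (volume : Measure (Ed d)).real (Metric.ball 0 1) with hV
  refine ⟨d * (V * (1 / ((d : ℝ) - β))), ?_, ?_⟩
  · have : 0 < (d : ℝ) - β := by linarith
    positivity
  intro R hR
  set f := (Iio R).indicator (fun r : ℝ => r ^ (-β)) with hf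
  have hdim : Module.finrank ℝ (Ed d) = d := finrank_euclideanSpace_fin
  have hfe : ∀ y ∈ Ioi (0 : ℝ), y ^ (Module.finrank ℝ (Ed d) - 1) • f y =
      (Iio R).indicator (fun y : ℝ => y ^ ((d : ℝ) - 1 - β)) y := by
    intro y hy
    have hy : 0 < y := hy
    rw [hdim, hf, smul_eq_mul]
    by_cases h : y < R
    · simp only [indicator, mem_Iio, h, if_true]
      rw [← rpow_natCast, ← rpow_add hy, Nat.cast_sub hd]
      congr 1
      push_cast; ring
    · simp [indicator, h]
  have hI : IntervalIntegrable (fun y : ℝ => y ^ ((d : ℝ) - 1 - β)) volume 0 R :=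
    intervalIntegral.intervalIntegrable_rpow' (by linarith)
  rw [intervalIntegrable_iff_integrableOn_Ioo_of_le hR.le] at hI
  have hint : Integrable (fun z : Ed d => f ‖z‖) := by
    rw [integrable_fun_norm_addHaar, integrableOn_congr_fun hfe measurableSet_Ioi,
      IntegrableOn, integrable_indicator_iff measurableSet_Iio, IntegrableOn,
      Measure.restrict_restrict measurableSet_Iio, Iio_inter_Ioi]
    exact hI
  rw [← ofReal_integral_eq_lintegral_ofReal hint]
  · apply le_of_eq
    congr 1
    rw [integral_fun_norm_addHaar, setIntegral_congr_fun measurableSet_Ioi hfe,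
      integral_indicator measurableSet_Iio,
      Measure.restrict_restrict measurableSet_Iio, Iio_inter_Ioi, ← integral_Ioc_eq_integral_Ioo,
      ← intervalIntegral.integral_of_le hR.le, integral_rpow (Or.inl (by linarith)), hdim,
      zero_rpow (by linarith)]
    simp only [nsmul_eq_mul, smul_eq_mul, sub_zero]
    rw [show (d : ℝ) - 1 - β + 1 = d - β by ring]
    ring
  · refine ae_of_all _ fun z => ?_
    simp only [Pi.zero_apply, hf, indicator]
    split_ifs <;> positivity

lemma sk_heatK (d : ℕ) (hd : 1 ≤ d) {β : ℝ} (hβ : 0 < β) (hβd : β < d) :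
    ∃ C : ℝ, 0 ≤ C ∧ ∀ τ : ℝ, 0 < τ → ∀ x y : Ed d,
      ∫⁻ y', ENNReal.ofReal (heatKernel d τ (x - y')) * skK d β y y' ≤
        ENNReal.ofReal (C * τ ^ (-β / 2)) := by
  obtain ⟨C, hC, hball⟩ := sk_ball d hd hβd
  refine ⟨C + 1, by positivity, fun τ hτ x y => ?_⟩
  set R := τ ^ (1 / 2 : ℝ) with hR
  have hRpos : 0 < R := by positivity
  have hheat := sk_heat_meas d
  have hh1 : Measurable fun y' => ENNReal.ofReal (heatKernel d τ (x - y')) :=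
    (hheat.comp (measurable_const.prodMk (measurable_const.sub measurable_id))).ennreal_ofReal
  have hpt : ∀ y' : Ed d, ENNReal.ofReal (heatKernel d τ (x - y')) * skK d β y y' ≤
      ENNReal.ofReal (τ ^ (-(d : ℝ) / 2)) *
        ENNReal.ofReal ((Iio R).indicator (fun r : ℝ => r ^ (-β)) ‖y - y'‖) +
      ENNReal.ofReal (heatKernel d τ (x - y')) * ENNReal.ofReal (τ ^ (-β / 2)) := by
    intro y'
    unfold skK
    by_cases h : ‖y - y'‖ < R
    · refine le_trans ?_ le_self_add
      simp only [indicator, mem_Iio, h, if_true]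
      gcongr
      exact sk_heat_le d hτ _
    · refine le_trans ?_ le_add_self
      gcongr
      have h1 : ‖y - y'‖ ^ (-β) ≤ R ^ (-β) :=
        rpow_le_rpow_of_nonpos hRpos (not_lt.1 h) (by linarith)
      refine h1.trans (le_of_eq ?_)
      rw [hR, ← rpow_mul hτ.le]
      congr 1; ring
  refine (lintegral_mono hpt).trans ?_
  rw [lintegral_add_right _ (hh1.mul_const _), lintegral_mul_const _ hh1,
    lintegral_const_mul' _ _ ENNReal.ofReal_ne_top, sk_heat_lintegral d hτ x, one_mul,
    lintegral_sub_left_eq_self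
      (fun z : Ed d => ENNReal.ofReal ((Iio R).indicator (fun r : ℝ => r ^ (-β)) ‖z‖)) y]
  have hb := hball R hRpos
  calc _ ≤ ENNReal.ofReal (τ ^ (-(d : ℝ) / 2)) * ENNReal.ofReal (C * R ^ ((d : ℝ) - β)) +
        ENNReal.ofReal (τ ^ (-β / 2)) := by gcongr
    _ = _ := by
      rw [← ENNReal.ofReal_mul (by positivity), ← ENNReal.ofReal_add (by positivity) (by positivity)]
      congr 1
      have : τ ^ (-(d : ℝ) / 2) * R ^ ((d : ℝ) - β) = τ ^ (-β / 2) := by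
        rw [hR, ← rpow_mul hτ.le, ← rpow_add hτ]
        congr 1; ring
      linear_combination C * this

lemma sk_heatD (d : ℕ) (hd : 1 ≤ d) {β : ℝ} (hβ : 0 < β) (hβd : β < d) :
    ∃ C : ℝ, 0 ≤ C ∧ ∀ τ : ℝ, 0 < τ → ∀ x : Ed d,
      skD d β (fun y => ENNReal.ofReal (heatKernel d τ (x - y)))
        (fun y => ENNReal.ofReal (heatKernel d τ (x - y))) ≤ ENNReal.ofReal (C * τ ^ (-β / 2)) := by
  obtain ⟨C, hC, hK⟩ := sk_heatK d hd hβ hβd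
  refine ⟨C, hC, fun τ hτ x => ?_⟩
  unfold skD
  have hh1 : Measurable fun y' => ENNReal.ofReal (heatKernel d τ (x - y')) :=
    ((sk_heat_meas d).comp
      (measurable_const.prodMk (measurable_const.sub measurable_id))).ennreal_ofReal
  calc _ ≤ ∫⁻ y, ENNReal.ofReal (heatKernel d τ (x - y)) * ENNReal.ofReal (C * τ ^ (-β / 2)) := by
        refine lintegral_mono fun y => ?_
        simp_rw [mul_assoc]
        rw [lintegral_const_mul' _ _ ENNReal.ofReal_ne_top]
        gcongr
        exact hK τ hτ x y
    _ = _ := by rw [lintegral_mul_const _ hh1, sk_heat_lintegral d hτ x, one_mul]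

/-- Kernel bound for a weight `G`. -/
def SkG (d : ℕ) (T α : ℝ) (G : ℝ → Ed d → ℝ≥0∞) : Prop :=
  ∃ n : ℝ → ℝ≥0∞, Measurable n ∧ ∫⁻ s in Ioc (0 : ℝ) T, n s * n s < ⊤ ∧
    ∀ s τ : ℝ, 0 < τ → ∀ x : Ed d,
      ∫⁻ y, ENNReal.ofReal (heatKernel d τ (x - y)) * G s y ≤ ENNReal.ofReal (τ ^ (-α)) * n s

lemma skG_one (d : ℕ) (T : ℝ) : SkG d T 0 (fun _ _ => 1) := by
  refine ⟨fun _ => 1, measurable_const, by simp, fun s τ hτ x => ?_⟩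
  simp [sk_heat_lintegral d hτ x]

lemma sk_meas2 {S E : Type*} [MeasurableSpace S] [MeasurableSpace E] (ν : Measure E) [SFinite ν]
    (F : S → E → E → ℝ≥0∞) (hF : Measurable fun q : (S × E) × E => F q.1.1 q.1.2 q.2) :
    Measurable fun s => ∫⁻ y, ∫⁻ y', F s y y' ∂ν ∂ν :=
  Measurable.lintegral_prod_right' (f := fun q : S × E => ∫⁻ y', F q.1 q.2 y' ∂ν)
    (Measurable.lintegral_prod_right' hF)

lemma skG_noise (d : ℕ) (hd : 1 ≤ d) {β T : ℝ} (hβ : 0 < β) (hβd : β < d)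
    {h : ℝ → Ed d → ℝ} (hh : Admissible d β T h) :
    SkG d T (β / 4) (fun s y => ∫⁻ y', skK d β y y' * ‖h s y'‖ₑ) := by
  obtain ⟨C, hC, hD⟩ := sk_heatD d hd hβ hβd
  obtain ⟨hm, hfin⟩ := hh
  have hm1 : ∀ s, Measurable fun y => ‖h s y‖ₑ := fun s =>
    (hm.comp (measurable_const.prodMk measurable_id)).enorm
  have hK := skK_meas d β
  have hDeq : ∀ s, skD d β (fun y => ‖h s y‖ₑ) (fun y => ‖h s y‖ₑ) =
      ∫⁻ y : Ed d, ∫⁻ y' : Ed d, ENNReal.ofReal (|h s y| * |h s y'| * ‖y - y'‖ ^ (-β)) := by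
    intro s
    unfold skD skK
    refine lintegral_congr fun y => lintegral_congr fun y' => ?_
    rw [ENNReal.ofReal_mul (by positivity), ENNReal.ofReal_mul (by positivity),
      ← Real.norm_eq_abs, ← Real.norm_eq_abs, ofReal_norm, ofReal_norm]
  have hDm : Measurable fun s => skD d β (fun y => ‖h s y‖ₑ) (fun y => ‖h s y‖ₑ) := by
    unfold skD
    refine sk_meas2 volume (fun s y y' => ‖h s y‖ₑ * ‖h s y'‖ₑ * skK d β y y') ?_
    have a1 : Measurable fun q : (ℝ × Ed d) × Ed d => ‖h q.1.1 q.1.2‖ₑ :=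
      (hm.comp measurable_fst).enorm
    have a2 : Measurable fun q : (ℝ × Ed d) × Ed d => ‖h q.1.1 q.2‖ₑ :=
      (hm.comp ((measurable_fst.comp measurable_fst).prodMk measurable_snd)).enorm
    have a3 : Measurable fun q : (ℝ × Ed d) × Ed d => skK d β q.1.2 q.2 := by
      unfold skK
      fun_prop
    exact (a1.mul a2).mul a3
  refine ⟨fun s => (ENNReal.ofReal C) ^ (1 / 2 : ℝ) *
    (skD d β (fun y => ‖h s y‖ₑ) (fun y => ‖h s y‖ₑ)) ^ (1 / 2 : ℝ),
    (hDm.pow_const _).const_mul _, ?_, fun s τ hτ x => ?_⟩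
  · have : ∀ a : ℝ≥0∞, a ^ (1 / 2 : ℝ) * a ^ (1 / 2 : ℝ) = a := by
      intro a
      rw [← ENNReal.rpow_add_of_nonneg _ _ (by norm_num) (by norm_num)]
      norm_num
    simp_rw [mul_mul_mul_comm, this]
    rw [lintegral_const_mul' _ _ ENNReal.ofReal_ne_top]
    simp_rw [hDeq]
    exact ENNReal.mul_lt_top ENNReal.ofReal_lt_top hfin
  · have hh1 : Measurable fun y' => ENNReal.ofReal (heatKernel d τ (x - y')) :=
      ((sk_heat_meas d).comp
        (measurable_const.prodMk (measurable_const.sub measurable_id))).ennreal_ofReal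
    have e1 : ∫⁻ y, ENNReal.ofReal (heatKernel d τ (x - y)) * ∫⁻ y', skK d β y y' * ‖h s y'‖ₑ =
        skD d β (fun y => ENNReal.ofReal (heatKernel d τ (x - y))) (fun y => ‖h s y‖ₑ) := by
      unfold skD
      refine lintegral_congr fun y => ?_
      rw [← lintegral_const_mul' _ _ ENNReal.ofReal_ne_top]
      refine lintegral_congr fun y' => ?_
      ring
    rw [e1]
    refine (skD_cs d hd hβ hh1 (hm1 s)).trans ?_
    rw [← mul_assoc]
    gcongr
    calc _ ≤ (ENNReal.ofReal (C * τ ^ (-β / 2))) ^ (1 / 2 : ℝ) := by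
          gcongr
          exact hD τ hτ x
      _ = _ := by
          rw [mul_comm C, ENNReal.ofReal_mul (by positivity),
            ENNReal.mul_rpow_of_nonneg _ _ (by norm_num),
            ENNReal.ofReal_rpow_of_nonneg (by positivity) (by norm_num), ← rpow_mul hτ.le]
          congr 3
          ring

lemma skG_small (d : ℕ) {T α : ℝ} (hα : α < 1 / 2) {G : ℝ → Ed d → ℝ≥0∞}
    (hG : SkG d T α G) {ε : ℝ≥0∞} (hε : 0 < ε) :
    ∀ᶠ l : ℝ in atTop, ∀ t ∈ Icc (0 : ℝ) T, ∀ x : Ed d,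
      ∫⁻ s in Ioc (0 : ℝ) t, ∫⁻ y, ENNReal.ofReal (rexp (-(l * (t - s)))) *
        (ENNReal.ofReal (heatKernel d (t - s) (x - y)) * G s y) ≤ ε := by
  obtain ⟨n, hn, hfin, hb⟩ := hG
  set A := ∫⁻ s in Ioc (0 : ℝ) T, n s * n s with hA
  have key : ∀ l : ℝ, 0 < l → ∀ t ∈ Icc (0 : ℝ) T, ∀ x : Ed d,
      ∫⁻ s in Ioc (0 : ℝ) t, ∫⁻ y, ENNReal.ofReal (rexp (-(l * (t - s)))) *
        (ENNReal.ofReal (heatKernel d (t - s) (x - y)) * G s y) ≤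
      (ENNReal.ofReal ((1 / (2 * l)) ^ (1 - 2 * α) * Gamma (1 - 2 * α))) ^ (1 / 2 : ℝ) *
        A ^ (1 / 2 : ℝ) := by
    intro l hl t ht x
    have hmeasf : Measurable fun s : ℝ =>
        ENNReal.ofReal (rexp (-(l * (t - s))) * (t - s) ^ (-α)) := by fun_prop
    rw [← restrict_Ioo_eq_restrict_Ioc]
    calc _ ≤ ∫⁻ s in Ioo (0 : ℝ) t,
          ENNReal.ofReal (rexp (-(l * (t - s))) * (t - s) ^ (-α)) * n s := by
          refine setLIntegral_mono (hmeasf.mul hn) fun s hs => ?_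
          have hts : 0 < t - s := by linarith [hs.2]
          rw [lintegral_const_mul' _ _ ENNReal.ofReal_ne_top,
            ENNReal.ofReal_mul (by positivity), mul_assoc]
          gcongr
          exact hb s (t - s) hts x
      _ ≤ _ := sk_cs _ hmeasf hn
      _ ≤ _ := by
          gcongr
          · rw [← sk_lintegral_gamma (by linarith) (by positivity),
              ← lintegral_indicator measurableSet_Ioi, ← lintegral_indicator measurableSet_Ioo,
              ← lintegral_sub_left_eq_self _ t]
            refine lintegral_mono fun s => ?_
            by_cases hs : t - s ∈ Ioo 0 t
            · have hts : 0 < s := by linarith [hs.2]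
              rw [indicator_of_mem hs, indicator_of_mem (show s ∈ Ioi 0 from hts),
                sub_sub_cancel, ← ENNReal.ofReal_mul (by positivity)]
              apply le_of_eq
              congr 1
              rw [mul_mul_mul_comm, ← Real.exp_add, ← rpow_add hts, mul_comm]
              congr 2 <;> ring
            · rw [indicator_of_notMem hs]
              exact zero_le
          · refine lintegral_mono_set fun s hs => ⟨hs.1, hs.2.le.trans ht.2⟩
  have hlim : Tendsto (fun l : ℝ =>
      (ENNReal.ofReal ((1 / (2 * l)) ^ (1 - 2 * α) * Gamma (1 - 2 * α))) ^ (1 / 2 : ℝ) *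
        A ^ (1 / 2 : ℝ)) atTop (𝓝 0) := by
    have h1 : Tendsto (fun l : ℝ => 1 / (2 * l)) atTop (𝓝 0) := by
      have := tendsto_inv_atTop_zero.comp (tendsto_id.const_mul_atTop (zero_lt_two (α := ℝ)))
      simpa [Function.comp_def] using this
    have h2 : Tendsto (fun l : ℝ => (1 / (2 * l)) ^ (1 - 2 * α) * Gamma (1 - 2 * α)) atTop
        (𝓝 0) := by
      have := (h1.rpow_const (p := 1 - 2 * α) (Or.inr (by linarith))).mul_const
        (Gamma (1 - 2 * α))
      rwa [zero_rpow (by linarith), zero_mul] at this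
    have h3 := (ENNReal.continuous_rpow_const (y := 1 / 2)).tendsto 0 |>.comp
      (by simpa using ENNReal.tendsto_ofReal h2)
    have h4 := ENNReal.Tendsto.mul_const (b := A ^ (1 / 2 : ℝ)) h3
      (Or.inr (ENNReal.rpow_ne_top_of_nonneg (by norm_num) hfin.ne))
    simpa [Function.comp_def] using h4
  filter_upwards [hlim.eventually (gt_mem_nhds hε), eventually_gt_atTop 0] with l hl hl0 t ht x
  exact (key l hl0 t ht x).trans hl.le

def SkGood {X : Type*} [MeasurableSpace X] (T : ℝ) (Φ : ℝ → X → ℝ) : Prop :=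
  Measurable (fun p : ℝ × X => Φ p.1 p.2) ∧ ∃ M : ℝ, ∀ t ∈ Icc (0 : ℝ) T, ∀ x, |Φ t x| ≤ M

lemma sk_zero_of_le {a C : ℝ} (h : ∀ n : ℕ, |a| ≤ C / 2 ^ n) : a = 0 := by
  have h1 : Tendsto (fun n : ℕ => C / 2 ^ n) atTop (𝓝 0) := by
    have := (tendsto_pow_atTop_nhds_zero_of_lt_one (r := (1 / 2 : ℝ)) (by norm_num)
      (by norm_num)).const_mul C
    simpa [div_eq_mul_inv] using this
  have h2 : |a| ≤ 0 := ge_of_tendsto' h1 h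
  exact abs_eq_zero.1 (le_antisymm h2 (abs_nonneg _))

lemma sk_fix {X : Type*} [MeasurableSpace X] {T l : ℝ} (hl : 0 ≤ l)
    (Γ : (ℝ → X → ℝ) → (ℝ → X → ℝ))
    (h0 : ∀ Φ, SkGood T Φ → SkGood T (Γ Φ))
    (hz : ∀ Φ, ∀ t ∉ Icc (0 : ℝ) T, ∀ x, Γ Φ t x = 0)
    (hc : ∀ Φ Ψ, SkGood T Φ → SkGood T Ψ → ∀ K : ℝ, 0 ≤ K →
      (∀ t ∈ Icc (0 : ℝ) T, ∀ x, |Φ t x - Ψ t x| ≤ K * rexp (l * t)) →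
      ∀ t ∈ Icc (0 : ℝ) T, ∀ x, |Γ Φ t x - Γ Ψ t x| ≤ K / 2 * rexp (l * t)) :
    ∃ Φ, SkGood T Φ ∧ (∀ t ∈ Icc (0 : ℝ) T, ∀ x, Φ t x = Γ Φ t x) ∧
      ∀ Φ', SkGood T Φ' → (∀ t ∈ Icc (0 : ℝ) T, ∀ x, Φ' t x = Γ Φ' t x) →
        ∀ t ∈ Icc (0 : ℝ) T, ∀ x, Φ' t x = Φ t x := by
  have hexp : ∀ t ∈ Icc (0 : ℝ) T, 1 ≤ rexp (l * t) := fun t ht =>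
    Real.one_le_exp (mul_nonneg hl ht.1)
  have hdiff : ∀ Φ Ψ : ℝ → X → ℝ, SkGood T Φ → SkGood T Ψ → ∃ K : ℝ, 0 ≤ K ∧
      ∀ t ∈ Icc (0 : ℝ) T, ∀ x, |Φ t x - Ψ t x| ≤ K * rexp (l * t) := by
    rintro Φ Ψ ⟨-, M, hM⟩ ⟨-, N, hN⟩
    refine ⟨|M| + |N|, by positivity, fun t ht x => ?_⟩
    have h1 := hM t ht x
    have h2 := hN t ht x
    have h3 := hexp t ht
    have h4 : |Φ t x - Ψ t x| ≤ |M| + |N| := by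
      refine (abs_sub _ _).trans ?_
      have := le_abs_self M
      have := le_abs_self N
      linarith
    exact h4.trans (le_mul_of_one_le_right (by positivity) h3)
  set φ : ℕ → ℝ → X → ℝ := fun n => Γ^[n] (fun _ _ => 0) with hφ
  have hφs : ∀ n, φ (n + 1) = Γ (φ n) := fun n => Function.iterate_succ_apply' _ _ _
  have hg0 : SkGood T (φ 0) := ⟨measurable_const, 0, fun t _ x => by simp [hφ]⟩
  have hg : ∀ n, SkGood T (φ n) := by
    intro n
    induction n with
    | zero => exact hg0
    | succ n ih => rw [hφs]; exact h0 _ ih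
  obtain ⟨K, hK, hK1⟩ := hdiff _ _ (hg 0) (hg 1)
  have hstep : ∀ n, ∀ t ∈ Icc (0 : ℝ) T, ∀ x,
      |φ n t x - φ (n + 1) t x| ≤ K / 2 ^ n * rexp (l * t) := by
    intro n
    induction n with
    | zero => simpa using hK1
    | succ n ih =>
      intro t ht x
      have := hc _ _ (hg n) (hg (n + 1)) (K / 2 ^ n) (by positivity) ih t ht x
      rw [← hφs, ← hφs] at this
      rw [pow_succ, ← div_div]
      exact this
  have hout : ∀ n, ∀ t ∉ Icc (0 : ℝ) T, ∀ x, φ n t x = 0 := by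
    intro n t ht x
    cases n with
    | zero => simp [hφ]
    | succ n => rw [hφs]; exact hz _ t ht x
  have hdist : ∀ t x n, dist (φ n t x) (φ (n + 1) t x) ≤ (2 * K * rexp (l * t)) / 2 / 2 ^ n := by
    intro t x n
    rw [Real.dist_eq]
    by_cases ht : t ∈ Icc (0 : ℝ) T
    · refine (hstep n t ht x).trans (le_of_eq ?_)
      ring
    · rw [hout n t ht, hout _ t ht]
      simp only [sub_zero, abs_zero]
      positivity
  have hlim : ∀ t x, ∃ a, Tendsto (fun n => φ n t x) atTop (𝓝 a) := fun t x =>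
    cauchySeq_tendsto_of_complete (cauchySeq_of_le_geometric_two (hdist t x))
  choose Φ hΦ using hlim
  have hΦd : ∀ n t x, |φ n t x - Φ t x| ≤ 2 * K / 2 ^ n * rexp (l * t) := by
    intro n t x
    have := dist_le_of_le_geometric_two_of_tendsto (hdist t x) (hΦ t x) n
    rw [Real.dist_eq] at this
    refine this.trans (le_of_eq ?_)
    ring
  have hGΦ : SkGood T Φ := by
    refine ⟨?_, 2 * K * rexp (l * T), fun t ht x => ?_⟩
    · refine measurable_of_tendsto_metrizable (fun n => (hg n).1) ?_
      rw [tendsto_pi_nhds]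
      exact fun p => hΦ p.1 p.2
    · have := hΦd 0 t x
      simp only [hφ, Function.iterate_zero, id, zero_sub, abs_neg, pow_zero, div_one] at this
      refine this.trans ?_
      have := ht.2
      gcongr
  refine ⟨Φ, hGΦ, fun t ht x => ?_, fun Φ' hΦ' he t ht x => ?_⟩
  · refine sub_eq_zero.1 (sk_zero_of_le (C := 2 * K * rexp (l * t)) fun n => ?_)
    have h1 := hΦd (n + 1) t x
    have h2 := hc _ _ (hg n) hGΦ (2 * K / 2 ^ n) (by positivity) (fun t _ x => hΦd n t x) t ht x
    rw [← hφs] at h2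
    have h3 : |Φ t x - Γ Φ t x| ≤ |φ (n + 1) t x - Φ t x| + |φ (n + 1) t x - Γ Φ t x| := by
      rw [abs_sub_comm (φ (n + 1) t x) (Φ t x)]
      exact abs_sub_le _ _ _
    refine h3.trans ((add_le_add h1 h2).trans (le_of_eq ?_))
    rw [pow_succ]; field_simp; ring
  · obtain ⟨K', hK', hb⟩ := hdiff _ _ hΦ' hGΦ
    have hfix : ∀ t ∈ Icc (0 : ℝ) T, ∀ x, Φ t x = Γ Φ t x := by
      intro t ht x
      refine sub_eq_zero.1 (sk_zero_of_le (C := 2 * K * rexp (l * t)) fun n => ?_)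
      have h1 := hΦd (n + 1) t x
      have h2 := hc _ _ (hg n) hGΦ (2 * K / 2 ^ n) (by positivity) (fun t _ x => hΦd n t x) t ht x
      rw [← hφs] at h2
      have h3 : |Φ t x - Γ Φ t x| ≤ |φ (n + 1) t x - Φ t x| + |φ (n + 1) t x - Γ Φ t x| := by
        rw [abs_sub_comm (φ (n + 1) t x) (Φ t x)]
        exact abs_sub_le _ _ _
      refine h3.trans ((add_le_add h1 h2).trans (le_of_eq ?_))
      rw [pow_succ]; field_simp; ring
    have hit : ∀ n : ℕ, ∀ t ∈ Icc (0 : ℝ) T, ∀ x,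
        |Φ' t x - Φ t x| ≤ K' / 2 ^ n * rexp (l * t) := by
      intro n
      induction n with
      | zero => simpa using hb
      | succ n ih =>
        intro t ht x
        have := hc _ _ hΦ' hGΦ (K' / 2 ^ n) (by positivity) ih t ht x
        rw [← he t ht x, ← hfix t ht x] at this
        rw [pow_succ, ← div_div]
        exact this
    refine sub_eq_zero.1 (sk_zero_of_le (C := K' * rexp (l * t)) fun n => ?_)
    refine (hit n t ht x).trans (le_of_eq ?_)
    ring

/-- The linear operator. -/
def skL (d : ℕ) (g u : ℝ → Ed d → ℝ) (t : ℝ) (x : Ed d) : ℝ :=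
  ∫ s in Ioc (0 : ℝ) t, ∫ y : Ed d, heatKernel d (t - s) (x - y) * u s y * g s y

lemma sk_measI {X Y : Type*} [MeasurableSpace X] [MeasurableSpace Y] (ν : Measure Y) [SFinite ν]
    (F : (ℝ × X) → ℝ → Y → ℝ)
    (hF : Measurable fun q : ((ℝ × X) × ℝ) × Y => F q.1.1 q.1.2 q.2) :
    Measurable fun p : ℝ × X => ∫ s in Ioc (0 : ℝ) p.1, ∫ y, F p s y ∂ν := by
  have h1 : StronglyMeasurable fun q : (ℝ × X) × ℝ => ∫ y, F q.1 q.2 y ∂ν :=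
    hF.stronglyMeasurable.integral_prod_right'
  simp_rw [← integral_indicator measurableSet_Ioc]
  have hs : MeasurableSet {q : (ℝ × X) × ℝ | q.2 ∈ Ioc 0 q.1.1} :=
    (measurableSet_lt measurable_const measurable_snd).inter
      (measurableSet_le measurable_snd (measurable_fst.comp measurable_fst))
  have h2 : StronglyMeasurable fun p : ℝ × X => ∫ s,
      {q : (ℝ × X) × ℝ | q.2 ∈ Ioc 0 q.1.1}.indicator (fun q => ∫ y, F q.1 q.2 y ∂ν) (p, s) :=
    (h1.indicator hs).integral_prod_right'
  exact h2.measurable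

lemma skL_meas (d : ℕ) {g u : ℝ → Ed d → ℝ} (hg : Measurable fun p : ℝ × Ed d => g p.1 p.2)
    (hu : Measurable fun p : ℝ × Ed d => u p.1 p.2) :
    Measurable fun p : ℝ × Ed d => skL d g u p.1 p.2 := by
  unfold skL
  refine sk_measI volume
    (fun p s y => heatKernel d (p.1 - s) (p.2 - y) * u s y * g s y) ?_
  have a1 : Measurable fun q : ((ℝ × Ed d) × ℝ) × Ed d =>
      heatKernel d (q.1.1.1 - q.1.2) (q.1.1.2 - q.2) := by
    unfold heatKernel; fun_prop
  have a0 : Measurable fun q : ((ℝ × Ed d) × ℝ) × Ed d => (q.1.2, q.2) := by fun_prop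
  have a2 : Measurable fun q : ((ℝ × Ed d) × ℝ) × Ed d => u q.1.2 q.2 := hu.comp a0
  have a3 : Measurable fun q : ((ℝ × Ed d) × ℝ) × Ed d => g q.1.2 q.2 := hg.comp a0
  exact (a1.mul a2).mul a3

lemma skG_fin (d : ℕ) {T α : ℝ} (hα : α < 1 / 2) {G : ℝ → Ed d → ℝ≥0∞}
    (hG : SkG d T α G) : ∃ B : ℝ≥0∞, B < ⊤ ∧ ∀ t ∈ Icc (0 : ℝ) T, ∀ x : Ed d,
      ∫⁻ s in Ioc (0 : ℝ) t, ∫⁻ y, ENNReal.ofReal (heatKernel d (t - s) (x - y)) * G s y ≤ B := by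
  obtain ⟨l, hl, hl0⟩ :=
    ((skG_small d hα hG (ε := 1) one_pos).and (eventually_gt_atTop 0)).exists
  refine ⟨ENNReal.ofReal (rexp (l * T)), ENNReal.ofReal_lt_top, fun t ht x => ?_⟩
  have h1 := hl t ht x
  calc _ ≤ ∫⁻ s in Ioc (0 : ℝ) t, ENNReal.ofReal (rexp (l * T)) *
        ∫⁻ y, ENNReal.ofReal (rexp (-(l * (t - s)))) *
        (ENNReal.ofReal (heatKernel d (t - s) (x - y)) * G s y) := by
        refine setLIntegral_mono' measurableSet_Ioc fun s hs => ?_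
        rw [lintegral_const_mul' _ _ ENNReal.ofReal_ne_top, ← mul_assoc,
          ← ENNReal.ofReal_mul (by positivity), ← Real.exp_add]
        have : 1 ≤ ENNReal.ofReal (rexp (l * T + -(l * (t - s)))) := by
          rw [ENNReal.one_le_ofReal]
          apply Real.one_le_exp
          have := ht.2
          have := hs.1
          nlinarith
        exact le_mul_of_one_le_left zero_le this
    _ = ENNReal.ofReal (rexp (l * T)) * _ := lintegral_const_mul' _ _ ENNReal.ofReal_ne_top
    _ ≤ ENNReal.ofReal (rexp (l * T)) * 1 := by gcongr
    _ = _ := mul_one _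

lemma skL_lbound (d : ℕ) {T l K : ℝ} (hK : 0 ≤ K) {G : ℝ → Ed d → ℝ≥0∞}
    {g u : ℝ → Ed d → ℝ} (hgG : ∀ s y, ‖g s y‖ₑ ≤ G s y)
    (hu : ∀ s ∈ Icc (0 : ℝ) T, ∀ y, |u s y| ≤ K * rexp (l * s))
    {ε : ℝ≥0∞} {t : ℝ} (ht : t ∈ Icc (0 : ℝ) T) (x : Ed d)
    (hε : ∫⁻ s in Ioc (0 : ℝ) t, ∫⁻ y, ENNReal.ofReal (rexp (-(l * (t - s)))) *
        (ENNReal.ofReal (heatKernel d (t - s) (x - y)) * G s y) ≤ ε) :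
    ∫⁻ s in Ioc (0 : ℝ) t, ∫⁻ y, ‖heatKernel d (t - s) (x - y) * u s y * g s y‖ₑ ≤
      ENNReal.ofReal (K * rexp (l * t)) * ε := by
  refine le_trans ?_ (mul_le_mul_right hε _)
  rw [← lintegral_const_mul' _ _ ENNReal.ofReal_ne_top]
  refine setLIntegral_mono' measurableSet_Ioc fun s hs => ?_
  rw [← lintegral_const_mul' _ _ ENNReal.ofReal_ne_top]
  refine lintegral_mono fun y => ?_
  rw [enorm_mul, enorm_mul, ← mul_assoc, ← ENNReal.ofReal_mul (by positivity),
    Real.enorm_of_nonneg (sk_heat_nonneg d (by linarith [hs.2]) _), ← mul_assoc,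
    mul_comm (ENNReal.ofReal (heatKernel d (t - s) (x - y))),
    show K * rexp (l * t) * rexp (-(l * (t - s))) = K * rexp (l * s) by
      rw [mul_assoc, ← Real.exp_add]; congr 2; ring]
  gcongr
  · rw [← ofReal_norm, Real.norm_eq_abs]
    exact ENNReal.ofReal_le_ofReal (hu s ⟨hs.1.le, hs.2.trans ht.2⟩ y)
  · exact hgG s y

lemma skL_bound (d : ℕ) {T l K : ℝ} (hK : 0 ≤ K) {G : ℝ → Ed d → ℝ≥0∞}
    {g u : ℝ → Ed d → ℝ} (hgG : ∀ s y, ‖g s y‖ₑ ≤ G s y)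
    (hu : ∀ s ∈ Icc (0 : ℝ) T, ∀ y, |u s y| ≤ K * rexp (l * s))
    {ε : ℝ} (hε0 : 0 ≤ ε) {t : ℝ} (ht : t ∈ Icc (0 : ℝ) T) (x : Ed d)
    (hε : ∫⁻ s in Ioc (0 : ℝ) t, ∫⁻ y, ENNReal.ofReal (rexp (-(l * (t - s)))) *
        (ENNReal.ofReal (heatKernel d (t - s) (x - y)) * G s y) ≤ ENNReal.ofReal ε) :
    |skL d g u t x| ≤ K * rexp (l * t) * ε := by
  have h1 := skL_lbound d hK hgG hu ht x hε
  rw [← ENNReal.ofReal_mul (by positivity)] at h1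
  have h2 : ‖skL d g u t x‖ₑ ≤ ENNReal.ofReal (K * rexp (l * t) * ε) := by
    refine le_trans ?_ h1
    unfold skL
    refine (enorm_integral_le_lintegral_enorm _).trans ?_
    exact lintegral_mono fun s => enorm_integral_le_lintegral_enorm _
  rw [← ofReal_norm, Real.norm_eq_abs] at h2
  exact (ENNReal.ofReal_le_ofReal_iff (by positivity)).1 h2

lemma sk_int2 {S Y : Type*} [MeasurableSpace S] [MeasurableSpace Y] (μ : Measure S) (ν : Measure Y)
    [SFinite μ] [SFinite ν] {F : S → Y → ℝ} (hF : Measurable fun q : S × Y => F q.1 q.2)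
    (hfin : ∫⁻ s, ∫⁻ y, ‖F s y‖ₑ ∂ν ∂μ < ⊤) :
    Integrable (fun q : S × Y => F q.1 q.2) (μ.prod ν) := by
  refine ⟨hF.aestronglyMeasurable, ?_⟩
  unfold HasFiniteIntegral
  rwa [lintegral_prod _ hF.enorm.aemeasurable]

lemma skL_integrable (d : ℕ) {T α : ℝ} (hα : α < 1 / 2) {G : ℝ → Ed d → ℝ≥0∞}
    (hG : SkG d T α G) {g u : ℝ → Ed d → ℝ} (hgG : ∀ s y, ‖g s y‖ₑ ≤ G s y)
    (hg : Measurable fun p : ℝ × Ed d => g p.1 p.2) (hu : SkGood T u)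
    {t : ℝ} (ht : t ∈ Icc (0 : ℝ) T) (x : Ed d) :
    Integrable (fun q : ℝ × Ed d => heatKernel d (t - q.1) (x - q.2) * u q.1 q.2 * g q.1 q.2)
      ((volume.restrict (Ioc (0 : ℝ) t)).prod volume) := by
  obtain ⟨B, hB, hBb⟩ := skG_fin d hα hG
  obtain ⟨hum, M, hM⟩ := hu
  refine sk_int2 _ _ (F := fun s y => heatKernel d (t - s) (x - y) * u s y * g s y) ?_ ?_
  · have a1 : Measurable fun q : ℝ × Ed d => heatKernel d (t - q.1) (x - q.2) := by
      unfold heatKernel; fun_prop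
    exact (a1.mul hum).mul hg
  · refine (skL_lbound d (l := 0) (K := |M|) (abs_nonneg _) hgG (T := T) ?_ ht x
      (ε := B) ?_).trans_lt ?_
    · intro s hs y
      simpa using (hM s hs y).trans (le_abs_self M)
    · simpa using hBb t ht x
    · exact ENNReal.mul_lt_top ENNReal.ofReal_lt_top hB

lemma skL_sub (d : ℕ) {T α : ℝ} (hα : α < 1 / 2) {G : ℝ → Ed d → ℝ≥0∞}
    (hG : SkG d T α G) {g u v : ℝ → Ed d → ℝ} (hgG : ∀ s y, ‖g s y‖ₑ ≤ G s y)
    (hg : Measurable fun p : ℝ × Ed d => g p.1 p.2) (hu : SkGood T u) (hv : SkGood T v)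
    {t : ℝ} (ht : t ∈ Icc (0 : ℝ) T) (x : Ed d) :
    skL d g u t x - skL d g v t x = skL d g (fun s y => u s y - v s y) t x := by
  have h := integral_integral_sub' (skL_integrable d hα hG hgG hg hu ht x)
    (skL_integrable d hα hG hgG hg hv ht x)
  unfold skL
  rw [← h]
  simp only [mul_sub, sub_mul, Pi.sub_apply]

def skJ (d : ℕ) (β : ℝ) (h : ℝ → Ed d → ℝ) (s : ℝ) (y : Ed d) : ℝ :=
  ∫ y' : Ed d, ‖y - y'‖ ^ (-β) * h s y'

lemma skJ_meas (d : ℕ) (β : ℝ) {h : ℝ → Ed d → ℝ}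
    (hm : Measurable fun p : ℝ × Ed d => h p.1 p.2) :
    Measurable fun p : ℝ × Ed d => skJ d β h p.1 p.2 := by
  unfold skJ
  have a1 : Measurable fun q : (ℝ × Ed d) × Ed d => ‖q.1.2 - q.2‖ ^ (-β) := by fun_prop
  have a0 : Measurable fun q : (ℝ × Ed d) × Ed d => (q.1.1, q.2) := by fun_prop
  have a2 : Measurable fun q : (ℝ × Ed d) × Ed d => h q.1.1 q.2 := hm.comp a0
  have a3 : StronglyMeasurable fun q : (ℝ × Ed d) × Ed d => ‖q.1.2 - q.2‖ ^ (-β) * h q.1.1 q.2 :=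
    (a1.mul a2).stronglyMeasurable
  exact a3.integral_prod_right'.measurable

lemma skJ_le (d : ℕ) (β : ℝ) (h : ℝ → Ed d → ℝ) (s : ℝ) (y : Ed d) :
    ‖skJ d β h s y‖ₑ ≤ ∫⁻ y', skK d β y y' * ‖h s y'‖ₑ := by
  unfold skJ
  refine (enorm_integral_le_lintegral_enorm _).trans (le_of_eq ?_)
  refine lintegral_congr fun y' => ?_
  rw [enorm_mul, Real.enorm_of_nonneg (by positivity)]
  rfl

lemma sk_noise_eq (d : ℕ) (β : ℝ) (σ : ℝ → ℝ) (h Φ : ℝ → Ed d → ℝ) (t : ℝ) (x : Ed d) :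
    (∫ s in Ioc (0 : ℝ) t, ∫ y : Ed d, ∫ y' : Ed d,
          heatKernel d (t - s) (x - y) * σ (Φ s y) * ‖y - y'‖ ^ (-β) * h s y') =
      skL d (skJ d β h) (fun s y => σ (Φ s y)) t x := by
  unfold skL skJ
  simp_rw [← integral_const_mul, mul_assoc]

lemma sk_drift_eq (d : ℕ) (b : ℝ → ℝ) (Φ : ℝ → Ed d → ℝ) (t : ℝ) (x : Ed d) :
    (∫ s in Ioc (0 : ℝ) t, ∫ y : Ed d, heatKernel d (t - s) (x - y) * b (Φ s y)) =
      skL d (fun _ _ => 1) (fun s y => b (Φ s y)) t x := by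
  unfold skL
  simp

lemma sk_lip {f : ℝ → ℝ} {L : NNReal} (hf : LipschitzWith L f) (a b : ℝ) :
    |f a - f b| ≤ L * |a - b| := by
  simpa [Real.dist_eq] using hf.dist_le_mul a b

lemma sk_good_comp {X : Type*} [MeasurableSpace X] {T : ℝ} {Φ : ℝ → X → ℝ} (hΦ : SkGood T Φ)
    {f : ℝ → ℝ} {L : NNReal} (hf : LipschitzWith L f) : SkGood T (fun s y => f (Φ s y)) := by
  obtain ⟨hm, M, hM⟩ := hΦ
  refine ⟨hf.continuous.measurable.comp hm, |f 0| + L * M, fun t ht x => ?_⟩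
  have h1 := sk_lip hf (Φ t x) 0
  rw [sub_zero] at h1
  have h2 : (L : ℝ) * |Φ t x| ≤ L * M := by gcongr; exact hM t ht x
  have h3 : |f (Φ t x)| ≤ |f (Φ t x) - f 0| + |f 0| := by
    simpa using abs_add_le (f (Φ t x) - f 0) (f 0)
  linarith

lemma skL_good (d : ℕ) {T α : ℝ} (hα : α < 1 / 2) {G : ℝ → Ed d → ℝ≥0∞}
    (hG : SkG d T α G) {g u : ℝ → Ed d → ℝ} (hgG : ∀ s y, ‖g s y‖ₑ ≤ G s y)
    (hg : Measurable fun p : ℝ × Ed d => g p.1 p.2) (hu : SkGood T u) :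
    SkGood T (skL d g u) := by
  refine ⟨skL_meas d hg hu.1, ?_⟩
  obtain ⟨B, hB, hBb⟩ := skG_fin d hα hG
  obtain ⟨hum, M, hM⟩ := hu
  refine ⟨|M| * rexp (0 * 0) * B.toReal, fun t ht x => ?_⟩
  have := skL_bound d (l := 0) (K := |M|) (abs_nonneg _) hgG (T := T) (u := u) ?_ 
    (ε := B.toReal) ENNReal.toReal_nonneg ht x ?_
  · simpa using this
  · intro s hs y
    simpa using (hM s hs y).trans (le_abs_self M)
  · rw [ENNReal.ofReal_toReal hB.ne]
    simpa using hBb t ht x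

lemma skL_contr (d : ℕ) {T α : ℝ} (hα : α < 1 / 2) {G : ℝ → Ed d → ℝ≥0∞}
    (hG : SkG d T α G) {g : ℝ → Ed d → ℝ} (hgG : ∀ s y, ‖g s y‖ₑ ≤ G s y)
    (hg : Measurable fun p : ℝ × Ed d => g p.1 p.2)
    {f : ℝ → ℝ} {L : NNReal} (hf : LipschitzWith L f) :
    ∀ᶠ l : ℝ in atTop, ∀ Φ Ψ, SkGood T Φ → SkGood T Ψ → ∀ K : ℝ, 0 ≤ K →
      (∀ t ∈ Icc (0 : ℝ) T, ∀ x, |Φ t x - Ψ t x| ≤ K * rexp (l * t)) →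
      ∀ t ∈ Icc (0 : ℝ) T, ∀ x, |skL d g (fun s y => f (Φ s y)) t x -
        skL d g (fun s y => f (Ψ s y)) t x| ≤ K / 4 * rexp (l * t) := by
  have hε : 0 < ENNReal.ofReal (1 / (4 * (L + 1))) := by
    rw [ENNReal.ofReal_pos]; positivity
  filter_upwards [skG_small d hα hG hε] with l hl Φ Ψ hΦ hΨ K hK hd t ht x
  rw [skL_sub d hα hG hgG hg (sk_good_comp hΦ hf) (sk_good_comp hΨ hf) ht x]
  refine (skL_bound d (K := L * K) (l := l) (by positivity) hgG (T := T) ?_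
    (by positivity) ht x (hl t ht x)).trans ?_
  · intro s hs y
    refine (sk_lip hf _ _).trans ?_
    rw [mul_assoc]
    gcongr
    exact hd s hs y
  · have h1 : (L : ℝ) * (1 / (4 * (L + 1))) ≤ 1 / 4 := by
      have : (0 : ℝ) ≤ L := L.2
      rw [mul_one_div, div_le_div_iff₀ (by positivity) (by norm_num)]
      linarith
    calc (L : ℝ) * K * rexp (l * t) * (1 / (4 * (L + 1)))
        = K * rexp (l * t) * (L * (1 / (4 * (L + 1)))) := by ring
      _ ≤ K * rexp (l * t) * (1 / 4) := by gcongr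
      _ = _ := by ring

lemma sk_abs_noise (d : ℕ) {β T α : ℝ} (hα : α < 1 / 2) {h : ℝ → Ed d → ℝ}
    (hG : SkG d T α (fun s y => ∫⁻ y', skK d β y y' * ‖h s y'‖ₑ))
    {u : ℝ → Ed d → ℝ} (hu : SkGood T u) {t : ℝ} (ht : t ∈ Icc (0 : ℝ) T) (x : Ed d) :
    (∫⁻ s in Ioc (0 : ℝ) t, ∫⁻ y : Ed d, ∫⁻ y' : Ed d,
      ENNReal.ofReal
        (|heatKernel d (t - s) (x - y) * u s y * ‖y - y'‖ ^ (-β) * h s y'|)) < ⊤ := by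
  obtain ⟨B, hB, hBb⟩ := skG_fin d hα hG
  obtain ⟨hum, M, hM⟩ := hu
  refine lt_of_le_of_lt ?_ (ENNReal.mul_lt_top (ENNReal.ofReal_lt_top (r := M)) hB)
  refine le_trans ?_ (mul_le_mul_right (hBb t ht x) _)
  rw [← lintegral_const_mul' _ _ ENNReal.ofReal_ne_top]
  refine setLIntegral_mono' measurableSet_Ioc fun s hs => ?_
  rw [← lintegral_const_mul' _ _ ENNReal.ofReal_ne_top]
  refine lintegral_mono fun y => ?_
  rw [← lintegral_const_mul' _ _ ENNReal.ofReal_ne_top,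
    ← lintegral_const_mul' _ _ ENNReal.ofReal_ne_top]
  refine lintegral_mono fun y' => ?_
  have hheat := sk_heat_nonneg d (show 0 ≤ t - s by linarith [hs.2]) (x - y)
  have hK : 0 ≤ ‖y - y'‖ ^ (-β) := by positivity
  have hu1 := hM s ⟨hs.1.le, hs.2.trans ht.2⟩ y
  have hM0 : 0 ≤ M := (abs_nonneg _).trans hu1
  unfold skK
  rw [← ofReal_norm, Real.norm_eq_abs, ← ENNReal.ofReal_mul hK, ← ENNReal.ofReal_mul hheat,
    ← ENNReal.ofReal_mul hM0]
  apply ENNReal.ofReal_le_ofReal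
  rw [abs_mul, abs_mul, abs_mul, abs_of_nonneg hheat, abs_of_nonneg hK]
  calc heatKernel d (t - s) (x - y) * |u s y| * ‖y - y'‖ ^ (-β) * |h s y'|
      ≤ heatKernel d (t - s) (x - y) * M * ‖y - y'‖ ^ (-β) * |h s y'| := by gcongr
    _ = _ := by ring

lemma sk_abs_drift (d : ℕ) {T : ℝ}
    {u : ℝ → Ed d → ℝ} (hu : SkGood T u) {t : ℝ} (ht : t ∈ Icc (0 : ℝ) T) (x : Ed d) :
    (∫⁻ s in Ioc (0 : ℝ) t, ∫⁻ y : Ed d,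
      ENNReal.ofReal (|heatKernel d (t - s) (x - y) * u s y|)) < ⊤ := by
  obtain ⟨B, hB, hBb⟩ := skG_fin d (by norm_num) (skG_one d T)
  obtain ⟨hum, M, hM⟩ := hu
  have := skL_lbound d (l := 0) (K := |M|) (abs_nonneg _) (T := T) (u := u)
    (g := fun _ _ => 1) (G := fun _ _ => 1) (by simp)
    (fun s hs y => by simpa using (hM s hs y).trans (le_abs_self M)) ht x (ε := B)
    (by simpa using hBb t ht x)
  refine lt_of_le_of_lt ?_ (this.trans_lt (ENNReal.mul_lt_top ENNReal.ofReal_lt_top hB))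
  apply le_of_eq
  refine lintegral_congr fun s => lintegral_congr fun y => ?_
  rw [← ofReal_norm, Real.norm_eq_abs, mul_one]

lemma sk_main (d : ℕ) (hd : 1 ≤ d)
    (β T : ℝ) (hβ0 : 0 < β) (hβ : β < min (d : ℝ) 2)
    (σ b : ℝ → ℝ) (hσ : ∃ L : NNReal, LipschitzWith L σ) (hb : ∃ L : NNReal, LipschitzWith L b)
    (w : ℝ → Ed d → ℝ)
    (hwcont : ContinuousOn (fun p : ℝ × Ed d => w p.1 p.2) (Icc (0 : ℝ) T ×ˢ univ))
    (hwbdd : ∃ M : ℝ, ∀ t ∈ Icc (0 : ℝ) T, ∀ x : Ed d, |w t x| ≤ M)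
    (h : ℝ → Ed d → ℝ) (hh : Admissible d β T h) :
    ∃ Φ : ℝ → Ed d → ℝ, IsSkeletonSolution d β T σ b w h Φ ∧
      ∀ Φ' : ℝ → Ed d → ℝ, IsSkeletonSolution d β T σ b w h Φ' →
        ∀ t ∈ Icc (0 : ℝ) T, ∀ x : Ed d, Φ' t x = Φ t x := by
  classical
  obtain ⟨Lσ, hσ⟩ := hσ
  obtain ⟨Lb, hb⟩ := hb
  obtain ⟨Mw, hMw⟩ := hwbdd
  have hβd : β < d := hβ.trans_le (min_le_left _ _)
  have hβ2 : β < 2 := hβ.trans_le (min_le_right _ _)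
  have hGn := skG_noise d hd hβ0 hβd hh
  have hαn : β / 4 < 1 / 2 := by linarith
  have hJm := skJ_meas d β hh.1
  have hJG := skJ_le d β h
  have hG1 := skG_one d T
  have h1G : ∀ (s : ℝ) (y : Ed d), ‖(1 : ℝ)‖ₑ ≤ (1 : ℝ≥0∞) := by simp
  have h1m : Measurable fun _ : ℝ × Ed d => (1 : ℝ) := measurable_const
  have hα1 : (0 : ℝ) < 1 / 2 := by norm_num
  obtain ⟨l, ⟨hln, hld⟩, hl0⟩ := (((skL_contr d hαn hGn hJG hJm hσ).and
    (skL_contr d hα1 hG1 (g := fun _ _ => 1) h1G h1m hb)).and (eventually_ge_atTop 0)).exists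
  set N : (ℝ → Ed d → ℝ) → ℝ → Ed d → ℝ := fun Φ => skL d (skJ d β h) (fun s y => σ (Φ s y))
    with hN
  set D : (ℝ → Ed d → ℝ) → ℝ → Ed d → ℝ := fun Φ => skL d (fun _ _ => 1) (fun s y => b (Φ s y))
    with hD
  set Γ : (ℝ → Ed d → ℝ) → ℝ → Ed d → ℝ := fun Φ t x =>
    if t ∈ Icc (0 : ℝ) T then w t x + N Φ t x + D Φ t x else 0 with hΓ
  have hΓin : ∀ Φ, ∀ t ∈ Icc (0 : ℝ) T, ∀ x, Γ Φ t x = w t x + N Φ t x + D Φ t x :=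
    fun Φ t ht x => if_pos ht
  have hNg : ∀ Φ, SkGood T Φ → SkGood T (N Φ) := fun Φ hΦ =>
    skL_good d hαn hGn hJG hJm (sk_good_comp hΦ hσ)
  have hDg : ∀ Φ, SkGood T Φ → SkGood T (D Φ) := fun Φ hΦ =>
    skL_good d hα1 hG1 h1G h1m (sk_good_comp hΦ hb)
  have h0 : ∀ Φ, SkGood T Φ → SkGood T (Γ Φ) := by
    intro Φ hΦ
    have hN1 := hNg Φ hΦ
    have hD1 := hDg Φ hΦ
    refine ⟨?_, ?_⟩
    · have hset : MeasurableSet (Icc (0 : ℝ) T ×ˢ (univ : Set (Ed d))) :=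
        measurableSet_Icc.prod MeasurableSet.univ
      have hw1 : Measurable ((Icc (0 : ℝ) T ×ˢ (univ : Set (Ed d))).piecewise
          (fun p : ℝ × Ed d => w p.1 p.2) (fun _ => 0)) :=
        hwcont.measurable_piecewise continuousOn_const hset
      have := ((hw1.add hN1.1).add hD1.1).indicator hset
      convert this using 1
      ext p
      by_cases hp : p.1 ∈ Icc (0 : ℝ) T
      · have hp' : p ∈ Icc (0 : ℝ) T ×ˢ (univ : Set (Ed d)) := ⟨hp, mem_univ _⟩
        rw [hΓin Φ p.1 hp, indicator_of_mem hp']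
        simp only [Pi.add_apply, Set.piecewise, if_pos hp']
      · have hp' : p ∉ Icc (0 : ℝ) T ×ˢ (univ : Set (Ed d)) := fun h => hp h.1
        rw [indicator_of_notMem hp']
        exact if_neg hp
    · obtain ⟨-, M1, hM1⟩ := hN1
      obtain ⟨-, M2, hM2⟩ := hD1
      refine ⟨Mw + M1 + M2, fun t ht x => ?_⟩
      rw [hΓin Φ t ht x]
      refine (abs_add_three _ _ _).trans ?_
      linarith [hMw t ht x, hM1 t ht x, hM2 t ht x]
  have hz : ∀ Φ, ∀ t ∉ Icc (0 : ℝ) T, ∀ x, Γ Φ t x = 0 := by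
    intro Φ t ht x
    exact if_neg ht
  have hc : ∀ Φ Ψ, SkGood T Φ → SkGood T Ψ → ∀ K : ℝ, 0 ≤ K →
      (∀ t ∈ Icc (0 : ℝ) T, ∀ x, |Φ t x - Ψ t x| ≤ K * rexp (l * t)) →
      ∀ t ∈ Icc (0 : ℝ) T, ∀ x, |Γ Φ t x - Γ Ψ t x| ≤ K / 2 * rexp (l * t) := by
    intro Φ Ψ hΦ hΨ K hK hdiff t ht x
    rw [hΓin Φ t ht x, hΓin Ψ t ht x]
    have e1 := hln Φ Ψ hΦ hΨ K hK hdiff t ht x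
    have e2 := hld Φ Ψ hΦ hΨ K hK hdiff t ht x
    have e3 : w t x + N Φ t x + D Φ t x - (w t x + N Ψ t x + D Ψ t x) =
      (N Φ t x - N Ψ t x) + (D Φ t x - D Ψ t x) := by ring
    rw [e3]
    refine (abs_add_le _ _).trans ((add_le_add e1 e2).trans (le_of_eq ?_))
    ring
  obtain ⟨Φ, hΦ, hfix, huniq⟩ := sk_fix (T := T) hl0 Γ h0 hz hc
  · refine ⟨Φ, ⟨hΦ.1, hΦ.2, fun t ht x => ?_, fun t ht x => ?_, fun t ht x => ?_⟩,
      fun Φ' hΦ' => ?_⟩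
    · exact sk_abs_noise d hαn hGn (sk_good_comp hΦ hσ) ht x
    · exact sk_abs_drift d (sk_good_comp hΦ hb) ht x
    · rw [sk_noise_eq, sk_drift_eq, hfix t ht x]
      exact hΓin Φ t ht x
    · refine huniq Φ' ⟨hΦ'.measurable, hΦ'.bounded⟩ fun t ht x => ?_
      rw [hΓin Φ' t ht x, hΦ'.eqn t ht x, sk_noise_eq, sk_drift_eq]

end SkProof

/-- Existence and uniqueness of a bounded measurable solution of the skeleton equation
associated with the stochastic heat equation with Riesz covariance, for Lipschitz `σ, b`,
bounded continuous initial contribution `w` and admissible `h`. -/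
theorem skeleton_equation_existence_uniqueness (d : ℕ) (hd : 1 ≤ d)
    (β T : ℝ) (hβ0 : 0 < β) (hβ : β < min (d : ℝ) 2) (hT : 0 < T)
    (σ b : ℝ → ℝ) (hσ : ∃ L : NNReal, LipschitzWith L σ) (hb : ∃ L : NNReal, LipschitzWith L b)
    (w : ℝ → Ed d → ℝ)
    (hwcont : ContinuousOn (fun p : ℝ × Ed d => w p.1 p.2) (Icc (0 : ℝ) T ×ˢ univ))
    (hwbdd : ∃ M : ℝ, ∀ t ∈ Icc (0 : ℝ) T, ∀ x : Ed d, |w t x| ≤ M)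
    (h : ℝ → Ed d → ℝ) (hh : Admissible d β T h) :
    ∃ Φ : ℝ → Ed d → ℝ, IsSkeletonSolution d β T σ b w h Φ ∧
      ∀ Φ' : ℝ → Ed d → ℝ, IsSkeletonSolution d β T σ b w h Φ' →
        ∀ t ∈ Icc (0 : ℝ) T, ∀ x : Ed d, Φ' t x = Φ t x := by
  exact sk_main d hd β T hβ0 hβ σ b hσ hb w hwcont hwbdd h hh

end
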